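/- arXiv:1510.07004 — 6 statements merged into one kernel-verified Lean document; each statement's English description precedes it below -/
import Mathlib

section
/- Let n, k, m be natural numbers, let σ_1, …, σ_n : ℝ^k → ℝ^m be fixed linear maps, and for u ∈ ℝ^n write σ(u) = Σ_α u_α σ_α. For a differentiable map A : ℝ^n → Hom(ℝ^k, ℝ^m) and differentiable ξ : ℝ^n → ℝ^k, define B_A(ξ)(x) = −Σ_α σ_αᵀ ∂_α(A(·)ξ(·))(x) + A(x)ᵀ (Σ_α σ_α ∂_α ξ(x)), where Mᵀ denotes the adjoint (transpose) of a linear map between Euclidean spaces. Then for every differentiable f : ℝ^n → ℝ, every differentiable ξ, and every x ∈ ℝ^n: B_A(fξ)(x) = f(x)·B_A(ξ)(x) + (A(x)ᵀ ∘ σ(∇f(x)) − σ(∇f(x))ᵀ ∘ A(x))(ξ(x)). In particular, if A(x)ᵀ ∘ σ(u) = σ(u)ᵀ ∘ A(x) for all x ∈ ℝ^n and u ∈ ℝ^n, then B_A(fξ) = f·B_A(ξ) for all f and ξ, i.e. B_A is a zeroth-order operator (a bundle map). -/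
open scoped BigOperators RealInnerProductSpace

/-- The symbol `σ(u) = Σ_α u_α σ_α` of the first-order operator `D = Σ_α σ_α ∂_α`. -/
noncomputable def symbolMap {n k m : ℕ}
    (σ : Fin n → (EuclideanSpace ℝ (Fin k) →L[ℝ] EuclideanSpace ℝ (Fin m)))
    (u : EuclideanSpace ℝ (Fin n)) :
    EuclideanSpace ℝ (Fin k) →L[ℝ] EuclideanSpace ℝ (Fin m) :=
  ∑ α, u α • σ α

/-- The operator `B_A ξ = D*(Aξ) + Aᵀ(Dξ)` where `D = Σ_α σ_α ∂_α` and
`D* = −Σ_α σ_αᵀ ∂_α`. -/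
noncomputable def BAop {n k m : ℕ}
    (σ : Fin n → (EuclideanSpace ℝ (Fin k) →L[ℝ] EuclideanSpace ℝ (Fin m)))
    (A : EuclideanSpace ℝ (Fin n) → (EuclideanSpace ℝ (Fin k) →L[ℝ] EuclideanSpace ℝ (Fin m)))
    (ξ : EuclideanSpace ℝ (Fin n) → EuclideanSpace ℝ (Fin k))
    (x : EuclideanSpace ℝ (Fin n)) : EuclideanSpace ℝ (Fin k) :=
  -(∑ α, ContinuousLinearMap.adjoint (σ α)
      (fderiv ℝ (fun y => A y (ξ y)) x (EuclideanSpace.single α 1)))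
  + ContinuousLinearMap.adjoint (A x)
      (∑ α, σ α (fderiv ℝ ξ x (EuclideanSpace.single α 1)))

theorem fderiv_apply_single_eq_gradient {n : ℕ} {f : EuclideanSpace ℝ (Fin n) → ℝ}
    {x : EuclideanSpace ℝ (Fin n)} (hf : DifferentiableAt ℝ f x) (α : Fin n) :
    fderiv ℝ f x (EuclideanSpace.single α 1) = gradient f x α := by
  rw [hf.hasGradientAt.hasFDerivAt.fderiv, InnerProductSpace.toDual_apply_apply,
    EuclideanSpace.inner_single_right]
  simp

theorem symbolMap_apply {n k m : ℕ}
    (σ : Fin n → (EuclideanSpace ℝ (Fin k) →L[ℝ] EuclideanSpace ℝ (Fin m)))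
    (u : EuclideanSpace ℝ (Fin n)) (v : EuclideanSpace ℝ (Fin k)) :
    symbolMap σ u v = ∑ α, u α • σ α v := by
  simp [symbolMap]

theorem adjoint_symbolMap_apply {n k m : ℕ}
    (σ : Fin n → (EuclideanSpace ℝ (Fin k) →L[ℝ] EuclideanSpace ℝ (Fin m)))
    (u : EuclideanSpace ℝ (Fin n)) (w : EuclideanSpace ℝ (Fin m)) :
    ContinuousLinearMap.adjoint (symbolMap σ u) w
      = ∑ α, u α • ContinuousLinearMap.adjoint (σ α) w := by
  simp [symbolMap, map_sum]

theorem BAop_smul {n k m : ℕ}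
    (σ : Fin n → (EuclideanSpace ℝ (Fin k) →L[ℝ] EuclideanSpace ℝ (Fin m)))
    {A : EuclideanSpace ℝ (Fin n) → (EuclideanSpace ℝ (Fin k) →L[ℝ] EuclideanSpace ℝ (Fin m))}
    {f : EuclideanSpace ℝ (Fin n) → ℝ}
    {ξ : EuclideanSpace ℝ (Fin n) → EuclideanSpace ℝ (Fin k)}
    {x : EuclideanSpace ℝ (Fin n)} (hA : DifferentiableAt ℝ A x)
    (hf : DifferentiableAt ℝ f x) (hξ : DifferentiableAt ℝ ξ x) :
    BAop σ A (fun y => f y • ξ y) x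
      = f x • BAop σ A ξ x
        + ((ContinuousLinearMap.adjoint (A x)).comp (symbolMap σ (gradient f x))
            - (ContinuousLinearMap.adjoint (symbolMap σ (gradient f x))).comp (A x)) (ξ x) := by
  have hAξ : DifferentiableAt ℝ (fun y => A y (ξ y)) x := hA.clm_apply hξ
  simp only [BAop, map_smul, fderiv_fun_smul hf hAξ, fderiv_fun_smul hf hξ,
    add_apply, sub_apply, ContinuousLinearMap.comp_apply,
    smul_apply, ContinuousLinearMap.smulRight_apply,
    fderiv_apply_single_eq_gradient hf, symbolMap_apply, adjoint_symbolMap_apply, map_add,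
    Finset.sum_add_distrib, ← Finset.smul_sum, smul_add, smul_neg]
  abel

/-- Euclidean form of Lemma 2.2: the commutator formula for `B_A` applied to `f·ξ`,
and in particular, under the concentration condition, `B_A` is a zeroth-order operator. -/
theorem stmt0 {n k m : ℕ}
    (σ : Fin n → (EuclideanSpace ℝ (Fin k) →L[ℝ] EuclideanSpace ℝ (Fin m)))
    (A : EuclideanSpace ℝ (Fin n) → (EuclideanSpace ℝ (Fin k) →L[ℝ] EuclideanSpace ℝ (Fin m)))
    (hA : Differentiable ℝ A) :
    (∀ f : EuclideanSpace ℝ (Fin n) → ℝ, Differentiable ℝ f →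
      ∀ ξ : EuclideanSpace ℝ (Fin n) → EuclideanSpace ℝ (Fin k), Differentiable ℝ ξ →
      ∀ x : EuclideanSpace ℝ (Fin n),
      BAop σ A (fun y => f y • ξ y) x
        = f x • BAop σ A ξ x
          + ((ContinuousLinearMap.adjoint (A x)).comp (symbolMap σ (gradient f x))
              - (ContinuousLinearMap.adjoint (symbolMap σ (gradient f x))).comp (A x)) (ξ x))
    ∧ ((∀ (x u : EuclideanSpace ℝ (Fin n)),
          (ContinuousLinearMap.adjoint (A x)).comp (symbolMap σ u)
            = (ContinuousLinearMap.adjoint (symbolMap σ u)).comp (A x)) →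
        ∀ f : EuclideanSpace ℝ (Fin n) → ℝ, Differentiable ℝ f →
        ∀ ξ : EuclideanSpace ℝ (Fin n) → EuclideanSpace ℝ (Fin k), Differentiable ℝ ξ →
        ∀ x : EuclideanSpace ℝ (Fin n),
        BAop σ A (fun y => f y • ξ y) x = f x • BAop σ A ξ x) := by
  refine ⟨fun f hf ξ hξ x => BAop_smul σ (hA x) (hf x) (hξ x), fun h f hf ξ hξ x => ?_⟩
  rw [BAop_smul σ (hA x) (hf x) (hξ x), h, sub_self, zero_apply, add_zero]
end

section
/- Let (X, μ) be a measure space, let E and F be finite-dimensional real inner product spaces, let ξ : X → E be measurable with ∫_X ‖ξ‖² dμ = 1, let A : X → Hom(E,F) and B : X → Hom(E,E) be measurable families of linear maps, and let Ω ⊆ X be a measurable set. Suppose: (i) there is M₁ ≥ 0 with ‖B(x)‖ ≤ M₁ (operator norm) for μ-a.e. x; (ii) there is κ > 0 with ‖A(x)(ξ(x))‖ ≥ κ‖ξ(x)‖ for μ-a.e. x ∈ Ω; (iii) s > 0 and C ≥ 0 are constants such that s·∫_X ⟨ξ(x), B(x)(ξ(x))⟩ dμ + s²·∫_X ‖A(x)(ξ(x))‖²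 dμ ≤ C·s (the integrals being finite). Then ∫_Ω ‖ξ(x)‖² dμ ≤ (M₁ + C)/(κ² · s). -/
open scoped RealInnerProductSpace
open MeasureTheory

/-- The quantitative core of the Concentration Principle (Proposition 2.4). -/
theorem stmt2 {X : Type*} [MeasurableSpace X] (μ : Measure X)
    {E F : Type*}
    [NormedAddCommGroup E] [InnerProductSpace ℝ E] [FiniteDimensional ℝ E]
    [MeasurableSpace E] [BorelSpace E]
    [NormedAddCommGroup F] [InnerProductSpace ℝ F] [FiniteDimensional ℝ F]
    (ξ : X → E) (hξ : Measurable ξ) (hξnorm : ∫ x, ‖ξ x‖ ^ 2 ∂μ = 1)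
    (A : X → (E →L[ℝ] F)) (hA : Measurable A)
    (B : X → (E →L[ℝ] E)) (hB : Measurable B)
    (Ω : Set X) (hΩ : MeasurableSet Ω)
    (M₁ : ℝ) (hM₁ : 0 ≤ M₁) (hBbd : ∀ᵐ x ∂μ, ‖B x‖ ≤ M₁)
    (κ : ℝ) (hκ : 0 < κ) (hAκ : ∀ᵐ x ∂μ, x ∈ Ω → κ * ‖ξ x‖ ≤ ‖(A x) (ξ x)‖)
    (s C : ℝ) (hs : 0 < s) (hC : 0 ≤ C)
    (hξ2 : Integrable (fun x => ‖ξ x‖ ^ 2) μ)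
    (hint1 : Integrable (fun x => ⟪ξ x, (B x) (ξ x)⟫) μ)
    (hint2 : Integrable (fun x => ‖(A x) (ξ x)‖ ^ 2) μ)
    (hineq : s * (∫ x, ⟪ξ x, (B x) (ξ x)⟫ ∂μ)
        + s ^ 2 * (∫ x, ‖(A x) (ξ x)‖ ^ 2 ∂μ) ≤ C * s) :
    ∫ x in Ω, ‖ξ x‖ ^ 2 ∂μ ≤ (M₁ + C) / (κ ^ 2 * s) := by
  have hB_lower : -M₁ ≤ ∫ x, ⟪ξ x, (B x) (ξ x)⟫ ∂μ := by
    calc -M₁ = ∫ x, -M₁ * ‖ξ x‖ ^ 2 ∂μ := by rw [integral_const_mul, hξnorm, mul_one]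
      _ ≤ _ := by
        refine integral_mono_ae (hξ2.const_mul _) hint1 ?_
        filter_upwards [hBbd] with x hx
        have hle : ‖(B x) (ξ x)‖ ≤ M₁ * ‖ξ x‖ := (B x).le_of_opNorm_le hx _
        have hcs := neg_le_of_abs_le (abs_real_inner_le_norm (ξ x) ((B x) (ξ x)))
        nlinarith [mul_le_mul_of_nonneg_left hle (norm_nonneg (ξ x))]
  have hA_lower : κ ^ 2 * ∫ x in Ω, ‖ξ x‖ ^ 2 ∂μ ≤ ∫ x, ‖(A x) (ξ x)‖ ^ 2 ∂μ := by
    calc κ ^ 2 * ∫ x in Ω, ‖ξ x‖ ^ 2 ∂μ = ∫ x in Ω, κ ^ 2 * ‖ξ x‖ ^ 2 ∂μ :=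
          (integral_const_mul _ _).symm
      _ ≤ ∫ x in Ω, ‖(A x) (ξ x)‖ ^ 2 ∂μ := by
        refine integral_mono_ae (hξ2.integrableOn.const_mul _) hint2.integrableOn ?_
        filter_upwards [(ae_restrict_iff' hΩ).2 hAκ] with x hx
        rw [← mul_pow]
        gcongr
      _ ≤ _ := setIntegral_le_integral hint2 (.of_forall fun x => by positivity)
  rw [le_div_iff₀ (by positivity)]
  refine le_of_mul_le_mul_left ?_ hs
  linarith [mul_le_mul_of_nonneg_left hB_lower hs.le,
    mul_le_mul_of_nonneg_left hA_lower (sq_nonneg s)]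
end

section
/- Let V, E, F be finite-dimensional real inner product spaces, and let c : V → Hom(E,F) be a linear map such that for every u ∈ V, c(u)* ∘ c(u) = ‖u‖²·id_E and c(u) ∘ c(u)* = ‖u‖²·id_F, where * denotes the adjoint with respect to the inner products. Let A : E → F be a linear map. Then the following are equivalent: (a) A* ∘ c(u) = c(u)* ∘ A for every u ∈ V; (b) c(u) ∘ A* = A ∘ c(u)* for every u ∈ V. -/
/-- If `C ∘ C'` is a nonzero scalar, then `B' ∘ C = C' ∘ B` implies
`C ∘ B' = B ∘ C'` for any linear maps in the respective directions. -/
theorem LinearMap.comp_eq_comp_of_comp_eq_smul_id {K E F : Type*} [Field K]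
    [AddCommGroup E] [Module K E] [AddCommGroup F] [Module K F]
    {C B : E →ₗ[K] F} {C' B' : F →ₗ[K] E} {r : K} (hr : r ≠ 0)
    (hC : C.comp C' = r • LinearMap.id) (h : B'.comp C = C'.comp B) :
    C.comp B' = B.comp C' := by
  refine smul_right_injective _ hr ?_
  calc r • C.comp B' = C.comp (B'.comp (C.comp C')) := by
        rw [hC, LinearMap.comp_smul, LinearMap.comp_smul, LinearMap.comp_id]
    _ = C.comp ((B'.comp C).comp C') := by rw [LinearMap.comp_assoc]
    _ = (C.comp C').comp (B.comp C') := by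
        simp only [h, LinearMap.comp_assoc]
    _ = r • B.comp C' := by rw [hC, LinearMap.smul_comp, LinearMap.id_comp]

/-- Lemma 2.6 of the paper: for a Dirac-type symbol `c` satisfying the Clifford
unitarity relations, the concentration condition for `(c, A)` is equivalent to the
concentration condition for the adjoint pair. -/
theorem stmt3 {V E F : Type*}
    [NormedAddCommGroup V] [InnerProductSpace ℝ V] [FiniteDimensional ℝ V]
    [NormedAddCommGroup E] [InnerProductSpace ℝ E] [FiniteDimensional ℝ E]
    [NormedAddCommGroup F] [InnerProductSpace ℝ F] [FiniteDimensional ℝ F]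
    (c : V →ₗ[ℝ] (E →ₗ[ℝ] F))
    (hc1 : ∀ u : V, (LinearMap.adjoint (c u)).comp (c u) = ‖u‖ ^ 2 • LinearMap.id)
    (hc2 : ∀ u : V, (c u).comp (LinearMap.adjoint (c u)) = ‖u‖ ^ 2 • LinearMap.id)
    (A : E →ₗ[ℝ] F) :
    (∀ u : V, (LinearMap.adjoint A).comp (c u) = (LinearMap.adjoint (c u)).comp A)
      ↔ (∀ u : V, (c u).comp (LinearMap.adjoint A) = A.comp (LinearMap.adjoint (c u))) := by
  constructor
  · intro h u
    rcases eq_or_ne u 0 with rfl | hu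
    · simp
    · exact LinearMap.comp_eq_comp_of_comp_eq_smul_id
        (pow_ne_zero 2 (norm_ne_zero_iff.mpr hu)) (hc2 u) (h u)
  · intro h u
    rcases eq_or_ne u 0 with rfl | hu
    · simp
    · exact (LinearMap.comp_eq_comp_of_comp_eq_smul_id
        (pow_ne_zero 2 (norm_ne_zero_iff.mpr hu)) (hc1 u) (h u).symm).symm
end

section
/- Fix s > 0. Let f : ℂ → ℂ be real-differentiable at every point with ∫_ℂ |f(z)|² dA(z) < ∞ (Lebesgue measure on ℂ ≅ ℝ²). Then f satisfies ∂̄f(z) + s·z·conj(f(z)) = 0 for all z ∈ ℂ if and only if there exists a real constant c such that f(z) = c·exp(−s·|z|²) for all z ∈ ℂ. -/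
open MeasureTheory

/-- The Wirtinger derivative `∂̄g(z) = ½(Dg(z)(1) + i·Dg(z)(i))`. -/
noncomputable def wirtingerDBar (g : ℂ → ℂ) (z : ℂ) : ℂ :=
  (1 / 2 : ℂ) * (fderiv ℝ g z 1 + Complex.I * fderiv ℝ g z Complex.I)

open Complex Set Filter Topology

/-- The value of `wirtingerDBar` read off from a Fréchet derivative. -/
theorem HasFDerivAt.wirtingerDBar_eq {g : ℂ → ℂ} {L : ℂ →L[ℝ] ℂ} {z : ℂ}
    (h : HasFDerivAt g L z) : wirtingerDBar g z = (1 / 2 : ℂ) * (L 1 + I * L I) := by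
  rw [wirtingerDBar, h.fderiv]

theorem Filter.EventuallyEq.wirtingerDBar_eq {g h : ℂ → ℂ} {z : ℂ} (hgh : g =ᶠ[𝓝 z] h) :
    wirtingerDBar g z = wirtingerDBar h z := by
  rw [wirtingerDBar, wirtingerDBar, hgh.fderiv_eq]

theorem wirtingerDBar_add {g h : ℂ → ℂ} {z : ℂ} (hg : DifferentiableAt ℝ g z)
    (hh : DifferentiableAt ℝ h z) :
    wirtingerDBar (fun w => g w + h w) z = wirtingerDBar g z + wirtingerDBar h z := by
  rw [(hg.hasFDerivAt.fun_add hh.hasFDerivAt).wirtingerDBar_eq, wirtingerDBar, wirtingerDBar]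
  simp only [add_apply]
  ring

theorem wirtingerDBar_mul {g h : ℂ → ℂ} {z : ℂ} (hg : DifferentiableAt ℝ g z)
    (hh : DifferentiableAt ℝ h z) :
    wirtingerDBar (fun w => g w * h w) z
      = g z * wirtingerDBar h z + h z * wirtingerDBar g z := by
  rw [(hg.hasFDerivAt.fun_mul hh.hasFDerivAt).wirtingerDBar_eq, wirtingerDBar, wirtingerDBar]
  simp only [add_apply, smul_apply, smul_eq_mul]
  ring

theorem wirtingerDBar_const_mul {g : ℂ → ℂ} {z : ℂ} (c : ℂ) (hg : DifferentiableAt ℝ g z) :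
    wirtingerDBar (fun w => c * g w) z = c * wirtingerDBar g z := by
  rw [(hg.hasFDerivAt.const_mul c).wirtingerDBar_eq, wirtingerDBar]
  simp only [smul_apply, smul_eq_mul]
  ring

theorem wirtingerDBar_eq_zero_iff {g : ℂ → ℂ} {z : ℂ} (hg : DifferentiableAt ℝ g z) :
    wirtingerDBar g z = 0 ↔ DifferentiableAt ℂ g z := by
  rw [differentiableAt_complex_iff_differentiableAt_real, wirtingerDBar]
  simp only [hg, true_and, smul_eq_mul]
  constructor
  · intro h
    linear_combination (-2 * I) * h + fderiv ℝ g z I * I_sq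
  · intro h
    linear_combination (I / 2) * h + fderiv ℝ g z 1 * I_sq / 2

theorem HasFDerivAt.wirtingerDBar_ofReal {r : ℂ → ℝ} {L : ℂ →L[ℝ] ℝ} {z : ℂ}
    (h : HasFDerivAt r L z) :
    HasFDerivAt (fun w => (r w : ℂ)) (ofRealCLM.comp L) z ∧
    wirtingerDBar (fun w => (r w : ℂ)) z = (1 / 2 : ℂ) * (L 1 + I * L I) := by
  have h' : HasFDerivAt (fun w => (r w : ℂ)) (ofRealCLM.comp L) z :=
    ofRealCLM.hasFDerivAt.comp z h
  exact ⟨h', by simp [h'.wirtingerDBar_eq]⟩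

theorem differentiable_normSq : Differentiable ℝ normSq := by
  intro z
  simp only [funext normSq_apply]
  have h1 : DifferentiableAt ℝ re z := reCLM.differentiableAt
  have h2 : DifferentiableAt ℝ im z := imCLM.differentiableAt
  exact (h1.mul h1).add (h2.mul h2)

theorem differentiableAt_gaussian (s : ℝ) (z : ℂ) :
    DifferentiableAt ℝ (fun w : ℂ => ((Real.exp (-s * normSq w) : ℝ) : ℂ)) z :=
  ofRealCLM.differentiableAt.comp z ((differentiable_normSq z).const_mul (-s)).exp

theorem wirtingerDBar_gaussian (s : ℝ) (z : ℂ) :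
    wirtingerDBar (fun w : ℂ => ((Real.exp (-s * normSq w) : ℝ) : ℂ)) z
      = -s * z * (Real.exp (-s * normSq z) : ℝ) := by
  have h1 : HasFDerivAt re reCLM z := reCLM.hasFDerivAt
  have h2 : HasFDerivAt im imCLM z := imCLM.hasFDerivAt
  have h := (((h1.mul h1).add (h2.mul h2)).const_mul (-s)).exp
  have h' : HasFDerivAt (fun w : ℂ => Real.exp (-s * normSq w)) _ z := h
  rw [h'.wirtingerDBar_ofReal.2]
  simp [normSq_apply]
  linear_combination (-(s : ℂ) * cexp (-(s * (z.re * z.re + z.im * z.im)))) * re_add_im z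

/-- The `∂̄`-derivative of `(1 - a x²)(1 - a y²)`, a cutoff vanishing on the boundary of a square. -/
theorem wirtingerDBar_cutoff (a : ℝ) (z : ℂ) :
    DifferentiableAt ℝ (fun w : ℂ => (((1 - a * w.re ^ 2) * (1 - a * w.im ^ 2) : ℝ) : ℂ)) z ∧
    wirtingerDBar (fun w : ℂ => (((1 - a * w.re ^ 2) * (1 - a * w.im ^ 2) : ℝ) : ℂ)) z
      = -(a : ℂ) * ((z.re * (1 - a * z.im ^ 2) : ℝ) + (z.im * (1 - a * z.re ^ 2) : ℝ) * I) := by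
  have h1 : HasFDerivAt re reCLM z := reCLM.hasFDerivAt
  have h2 : HasFDerivAt im imCLM z := imCLM.hasFDerivAt
  have h := (((h1.pow 2).const_mul a).const_sub 1).mul (((h2.pow 2).const_mul a).const_sub 1)
  have h' : HasFDerivAt (fun w : ℂ => (1 - a * w.re ^ 2) * (1 - a * w.im ^ 2)) _ z := h
  refine ⟨h'.wirtingerDBar_ofReal.1.differentiableAt, ?_⟩
  rw [h'.wirtingerDBar_ofReal.2]
  simp
  ring

theorem intervalIntegral_intervalIntegral_eq_setIntegral_reProdIm {G : ℂ → ℂ} {a b c d : ℝ}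
    (hab : a ≤ b) (hcd : c ≤ d) (hG : IntegrableOn G (Icc a b ×ℂ Icc c d)) :
    ∫ x in a..b, ∫ y in c..d, G (x + y * I) = ∫ z in Icc a b ×ℂ Icc c d, G z := by
  have hmp := volume_preserving_equiv_real_prod.symm
  have hpre : measurableEquivRealProd.symm ⁻¹' (Icc a b ×ℂ Icc c d) = Icc a b ×ˢ Icc c d := by
    ext p
    simp [mem_reProdIm, -Icc_prod_Icc]
  have hint := (hmp.integrableOn_comp_preimage
    measurableEquivRealProd.symm.measurableEmbedding).2 hG
  rw [← hmp.setIntegral_preimage_emb measurableEquivRealProd.symm.measurableEmbedding, hpre,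
    Measure.volume_eq_prod, setIntegral_prod]
  · rw [intervalIntegral.integral_of_le hab, integral_Icc_eq_integral_Ioc]
    refine integral_congr_ae (Eventually.of_forall fun x => ?_)
    simp only
    rw [intervalIntegral.integral_of_le hcd, integral_Icc_eq_integral_Ioc]
    simp [mk_eq_add_mul_I]
  · rw [hpre] at hint
    exact hint

/-- If `F` vanishes on the boundary of a square then `∂̄F` has integral zero over it. -/
theorem setIntegral_wirtingerDBar_eq_zero {F G : ℂ → ℂ} {R : ℝ} (hR : 0 ≤ R) (p : ℂ)
    (hF : Continuous F) (hFd : ∀ z ≠ p, DifferentiableAt ℝ F z) (hG : Continuous G)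
    (hFG : ∀ z ≠ p, wirtingerDBar F z = G z)
    (hb : ∀ z : ℂ, |z.re| = R ∨ |z.im| = R → F z = 0) :
    ∫ z in Icc (-R) R ×ℂ Icc (-R) R, G z = 0 := by
  have hRR : -R ≤ R := by linarith
  have hae : (fun z => I • fderiv ℝ F z 1 - fderiv ℝ F z I) =ᵐ[volume]
      fun z => (2 * I) * G z := by
    have : ∀ᵐ z : ℂ, z ≠ p := by simp [ae_iff, measure_singleton]
    filter_upwards [this] with z hz
    rw [← hFG z hz, wirtingerDBar, smul_eq_mul]
    linear_combination (-fderiv ℝ F z I) * I_sq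
  have hGi : IntegrableOn (fun z => (2 * I) * G z) (Icc (-R) R ×ℂ Icc (-R) R) :=
    (continuous_const.mul hG).continuousOn.integrableOn_compact
      (isCompact_Icc.reProdIm isCompact_Icc)
  have hFi := hGi.congr_fun_ae (ae_restrict_of_ae hae.symm)
  have key := integral_boundary_rect_of_hasFDerivAt_real_off_countable F (fderiv ℝ F)
    ⟨-R, -R⟩ ⟨R, R⟩ {p} (countable_singleton p) hF.continuousOn
    (fun z hz => (hFd z hz.2).hasFDerivAt) (by simpa only [uIcc_of_le hRR] using hFi)
  simp only at key
  rw [intervalIntegral_intervalIntegral_eq_setIntegral_reProdIm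
      (G := fun z => I • fderiv ℝ F z 1 - fderiv ℝ F z I) hRR hRR hFi,
    integral_congr_ae (ae_restrict_of_ae hae), integral_const_mul] at key
  have e1 (x : ℝ) : F (x + (-R : ℝ) * I) = 0 := hb _ (Or.inr (by simp [abs_of_nonneg hR]))
  have e2 (x : ℝ) : F (x + R * I) = 0 := hb _ (Or.inr (by simp [abs_of_nonneg hR]))
  have e3 (y : ℝ) : F (R + y * I) = 0 := hb _ (Or.inl (by simp [abs_of_nonneg hR]))
  have e4 (y : ℝ) : F ((-R : ℝ) + y * I) = 0 := hb _ (Or.inl (by simp [abs_of_nonneg hR]))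
  simp only [e1, e2, e3, e4] at key
  simpa using key.symm

theorem aecover_square :
    AECover (volume : Measure ℂ) atTop (fun r : ℝ => Icc (-r) r ×ℂ Icc (-r) r) where
  ae_eventually_mem := Eventually.of_forall fun z => by
    filter_upwards [eventually_ge_atTop |z.re|, eventually_ge_atTop |z.im|] with r h1 h2
    exact ⟨abs_le.1 h1, abs_le.1 h2⟩
  measurableSet r := (isCompact_Icc.reProdIm isCompact_Icc).measurableSet

/-- A solution of `∂̄P = -2 s z N` with `P 0 = 0` and `|P| ≤ N` integrable forces `N = 0`. -/
theorem eq_zero_of_wirtingerDBar_eq {s : ℝ} (hs : 0 < s) {P : ℂ → ℂ} {N : ℂ → ℝ}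
    (hP : Differentiable ℝ P) (hP0 : P 0 = 0) (hN : Continuous N) (hNi : Integrable N)
    (hPN : ∀ z, ‖P z‖ ≤ N z) (hdbar : ∀ z, wirtingerDBar P z = -(2 * s) * z * N z) : N = 0 := by
  have hN0 (z : ℂ) : 0 ≤ N z := (norm_nonneg _).trans (hPN z)
  have hP0d : DifferentiableAt ℂ P 0 := (wirtingerDBar_eq_zero_iff (hP 0)).1 (by simp [hdbar])
  set k : ℂ → ℂ := dslope P 0 with hk
  have hkz (z : ℂ) : z * k z = P z := by
    simpa [hP0] using sub_smul_dslope P 0 z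
  have hkc : Continuous k := continuous_iff_continuousAt.2 fun z => by
    rcases eq_or_ne z 0 with rfl | hz
    · exact continuousAt_dslope_same.2 hP0d
    · exact (continuousAt_dslope_of_ne hz).2 (hP z).continuousAt
  have hkinv (z : ℂ) (hz : z ≠ 0) : k =ᶠ[𝓝 z] fun w => w⁻¹ * P w := by
    filter_upwards [eventually_ne_nhds hz] with w hw
    rw [← hkz w, inv_mul_cancel_left₀ hw]
  have hinv (z : ℂ) (hz : z ≠ 0) : DifferentiableAt ℂ (fun w : ℂ => w⁻¹) z :=
    differentiableAt_inv hz
  have hkd (z : ℂ) (hz : z ≠ 0) : DifferentiableAt ℝ k z :=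
    (((hinv z hz).restrictScalars ℝ).mul (hP z)).congr_of_eventuallyEq (hkinv z hz)
  have hkdbar (z : ℂ) (hz : z ≠ 0) : wirtingerDBar k z = -(2 * s) * N z := by
    have hr := (hinv z hz).restrictScalars ℝ
    rw [(hkinv z hz).wirtingerDBar_eq, wirtingerDBar_mul hr (hP z), hdbar,
      (wirtingerDBar_eq_zero_iff hr).2 (hinv z hz)]
    field_simp
    ring
  have hbound : ∀ r : ℝ, 0 < r →
      s * ∫ z in Icc (-r) r ×ℂ Icc (-r) r, N z ≤ (4 * r ^ 2)⁻¹ * ∫ z, N z := by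
    intro r hr
    set a : ℝ := (4 * r ^ 2)⁻¹ with ha
    have ha0 : 0 < a := by positivity
    have har : a * (2 * r) ^ 2 = 1 := by rw [ha]; field_simp; ring
    set φ : ℂ → ℝ := fun w => (1 - a * w.re ^ 2) * (1 - a * w.im ^ 2) with hφ
    set D : ℂ → ℂ := fun z =>
      -(a : ℂ) * ((z.re * (1 - a * z.im ^ 2) : ℝ) + (z.im * (1 - a * z.re ^ 2) : ℝ) * I) with hD
    have hφd (z : ℂ) : DifferentiableAt ℝ (fun w => (φ w : ℂ)) z := (wirtingerDBar_cutoff a z).1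
    have hφD (z : ℂ) : wirtingerDBar (fun w => (φ w : ℂ)) z = D z := (wirtingerDBar_cutoff a z).2
    have hφc : Continuous φ := by fun_prop
    have hDc : Continuous D := by fun_prop
    have hsq (t : ℝ) (ht : t ∈ Icc (-(2 * r)) (2 * r)) :
        0 ≤ 1 - a * t ^ 2 ∧ 1 - a * t ^ 2 ≤ 1 := by
      have : t ^ 2 ≤ (2 * r) ^ 2 := sq_le_sq' ht.1 ht.2
      constructor <;> nlinarith [mul_le_mul_of_nonneg_left this ha0.le, sq_nonneg t]
    have hsq' (t : ℝ) (ht : t ∈ Icc (-r) r) : 3 / 4 ≤ 1 - a * t ^ 2 := by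
      have : t ^ 2 ≤ r ^ 2 := sq_le_sq' ht.1 ht.2
      nlinarith [mul_le_mul_of_nonneg_left this ha0.le]
    set Q : Set ℂ := Icc (-(2 * r)) (2 * r) ×ℂ Icc (-(2 * r)) (2 * r) with hQ
    have hQc : IsCompact Q := isCompact_Icc.reProdIm isCompact_Icc
    have hsub : Icc (-r) r ×ℂ Icc (-r) r ⊆ Q := fun z hz =>
      ⟨⟨by linarith [hz.1.1], by linarith [hz.1.2]⟩, ⟨by linarith [hz.2.1], by linarith [hz.2.2]⟩⟩
    have hzero : ∫ z in Q, ((φ z : ℂ) * (-(2 * s) * N z) + k z * D z) = 0 := by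
      refine setIntegral_wirtingerDBar_eq_zero (F := fun z => (φ z : ℂ) * k z) (by positivity) 0
        (by fun_prop) (fun z hz => (hφd z).mul (hkd z hz)) (by fun_prop) (fun z hz => ?_)
        fun z hz => ?_
      · rw [wirtingerDBar_mul (hφd z) (hkd z hz), hkdbar z hz, hφD]
      · have : φ z = 0 := by
          simp only [hφ]
          rw [← sq_abs z.re, ← sq_abs z.im]
          rcases hz with hz | hz <;> rw [hz, har] <;> ring
        simp [this]
    have hφNi : IntegrableOn (fun z => φ z * N z) Q :=
      (hφc.mul hN).continuousOn.integrableOn_compact hQc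
    have hkDi : IntegrableOn (fun z => k z * D z) Q :=
      (hkc.mul hDc).continuousOn.integrableOn_compact hQc
    have heq : ((2 * s * ∫ z in Q, φ z * N z : ℝ) : ℂ) = ∫ z in Q, k z * D z := by
      have h1 : ∀ z, (φ z : ℂ) * (-(2 * s) * N z) = ((-(2 * s) * (φ z * N z) : ℝ) : ℂ) := by
        intro z; push_cast; ring
      simp only [h1] at hzero
      have h2 : IntegrableOn (fun z => ((-(2 * s) * (φ z * N z) : ℝ) : ℂ)) Q :=
        (hφNi.const_mul _).ofReal
      rw [integral_add h2 hkDi, integral_complex_ofReal, integral_const_mul] at hzero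
      push_cast at hzero ⊢
      linear_combination -hzero
    have hDle (z : ℂ) (hz : z ∈ Q) : ‖D z‖ ≤ a * ‖z‖ := by
      rw [hD, norm_mul, norm_neg, norm_real, Real.norm_of_nonneg ha0.le]
      refine mul_le_mul_of_nonneg_left ?_ ha0.le
      rw [norm_add_mul_I, norm_eq_sqrt_sq_add_sq, mul_pow, mul_pow]
      obtain ⟨h1, h2⟩ := hsq _ hz.1
      obtain ⟨h3, h4⟩ := hsq _ hz.2
      exact Real.sqrt_le_sqrt (add_le_add
        (mul_le_of_le_one_right (sq_nonneg _) (pow_le_one₀ h3 h4))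
        (mul_le_of_le_one_right (sq_nonneg _) (pow_le_one₀ h1 h2)))
    have hkD : ‖∫ z in Q, k z * D z‖ ≤ a * ∫ z, N z := by
      calc ‖∫ z in Q, k z * D z‖ ≤ ∫ z in Q, a * N z := by
            refine norm_integral_le_of_norm_le (hNi.const_mul a).integrableOn
              ((ae_restrict_iff' hQc.measurableSet).2 (Eventually.of_forall fun z hz => ?_))
            calc ‖k z * D z‖ ≤ ‖k z‖ * (a * ‖z‖) := by
                  rw [norm_mul]
                  exact mul_le_mul_of_nonneg_left (hDle z hz) (norm_nonneg _)
              _ = a * ‖P z‖ := by rw [← hkz z, norm_mul]; ring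
              _ ≤ a * N z := mul_le_mul_of_nonneg_left (hPN z) ha0.le
        _ = a * ∫ z in Q, N z := integral_const_mul _ _
        _ ≤ a * ∫ z, N z := mul_le_mul_of_nonneg_left
            (setIntegral_le_integral hNi (Eventually.of_forall hN0)) ha0.le
    have hlow : (1 / 2) * ∫ z in Icc (-r) r ×ℂ Icc (-r) r, N z ≤ ∫ z in Q, φ z * N z := by
      rw [← integral_const_mul]
      refine (setIntegral_mono_on (hNi.const_mul _).integrableOn (hφNi.mono_set hsub)
        (isCompact_Icc.reProdIm isCompact_Icc).measurableSet fun z hz => ?_).trans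
        (setIntegral_mono_set hφNi ?_ hsub.eventuallyLE)
      · refine mul_le_mul_of_nonneg_right ?_ (hN0 z)
        nlinarith [hsq' _ hz.1, hsq' _ hz.2]
      · refine (ae_restrict_iff' hQc.measurableSet).2 (Eventually.of_forall fun z hz => ?_)
        exact mul_nonneg (mul_nonneg (hsq _ hz.1).1 (hsq _ hz.2).1) (hN0 z)
    have hre : 2 * s * ∫ z in Q, φ z * N z ≤ a * ∫ z, N z := by
      refine (le_abs_self _).trans ?_
      rw [← Real.norm_eq_abs, ← norm_real, heq]
      exact hkD
    nlinarith [mul_le_mul_of_nonneg_left hlow hs.le]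
  have hlim := (aecover_square.integral_tendsto_of_countably_generated hNi).const_mul s
  have hlim' : Tendsto (fun r : ℝ => (4 * r ^ 2)⁻¹ * ∫ z, N z) atTop (𝓝 (0 * ∫ z, N z)) :=
    (((tendsto_pow_atTop two_ne_zero).const_mul_atTop (by norm_num)).inv_tendsto_atTop).mul_const _
  have hle := le_of_tendsto_of_tendsto hlim hlim'
    ((eventually_gt_atTop 0).mono hbound)
  have hint : ∫ z, N z = 0 := by
    have : 0 ≤ ∫ z, N z := integral_nonneg fun z => hN0 z
    nlinarith
  exact (Continuous.ae_eq_iff_eq volume hN continuous_const).1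
    ((integral_eq_zero_iff_of_nonneg hN0 hNi).1 hint)

theorem integrable_gaussian_sq {s : ℝ} (hs : 0 < s) :
    Integrable (fun z : ℂ => Real.exp (-s * normSq z) ^ 2) := by
  have h := (GaussianFourier.integrable_cexp_neg_mul_sq_norm_add (V := ℂ) (b := ((2 * s : ℝ) : ℂ))
    (by simpa using hs) 0 0).norm
  refine h.congr (Eventually.of_forall fun z => ?_)
  simp only [norm_exp, ← Real.exp_nat_mul, normSq_eq_norm_sq]
  congr 1
  norm_cast
  simp
  ring

/-- Example 1 of the paper: the kernel of the perturbed operator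
`D_s f = ∂̄f + s·z·f̄` on L² functions is `ℝ·e^{−s|z|²}`. -/
theorem stmt6 (s : ℝ) (hs : 0 < s) (f : ℂ → ℂ)
    (hf : ∀ z : ℂ, DifferentiableAt ℝ f z)
    (hL2 : Integrable (fun z : ℂ => ‖f z‖ ^ 2)) :
    (∀ z : ℂ, wirtingerDBar f z + (s : ℂ) * z * (starRingEnd ℂ) (f z) = 0)
      ↔ ∃ c : ℝ, ∀ z : ℂ,
          f z = (c : ℂ) * (Real.exp (-s * Complex.normSq z) : ℝ) := by
  constructor
  · intro h
    set g : ℂ → ℝ := fun z => Real.exp (-s * normSq z) with hg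
    set α : ℝ := (f 0).re with hα
    set β : ℝ := (f 0).im with hβ
    have hgd (z : ℂ) : DifferentiableAt ℝ (fun w => (g w : ℂ)) z := differentiableAt_gaussian s z
    have hgD (z : ℂ) : wirtingerDBar (fun w => (g w : ℂ)) z = -s * z * g z :=
      wirtingerDBar_gaussian s z
    set u : ℂ → ℂ := fun z => f z + (-α : ℂ) * g z with hu
    have hud (z : ℂ) : DifferentiableAt ℝ u z := (hf z).add ((hgd z).const_mul _)
    have huD (z : ℂ) : wirtingerDBar u z = -s * z * (starRingEnd ℂ) (u z) := by
      rw [wirtingerDBar_add (hf z) ((hgd z).const_mul _), wirtingerDBar_const_mul _ (hgd z), hgD]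
      simp only [hu, map_add, map_mul, map_neg, conj_ofReal]
      linear_combination h z
    have huc : Continuous u := continuous_iff_continuousAt.2 fun z => (hud z).continuousAt
    have hg0 (z : ℂ) : 0 ≤ g z := Real.exp_nonneg _
    have hgc : Continuous g := by
      have := differentiable_normSq.continuous
      fun_prop
    have hgi : Integrable (fun z => g z ^ 2) := integrable_gaussian_sq hs
    have hui : Integrable (fun z => ‖u z‖ ^ 2) := by
      refine ((hL2.const_mul 2).add (hgi.const_mul (2 * α ^ 2))).mono'
        (huc.norm.pow 2).aestronglyMeasurable (Eventually.of_forall fun z => ?_)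
      have h1 : ‖u z‖ ≤ ‖f z‖ + |α| * g z := by
        refine (norm_add_le _ _).trans_eq ?_
        rw [norm_mul, norm_neg, norm_real, norm_real, Real.norm_of_nonneg (hg0 z), Real.norm_eq_abs]
      have h2 : 0 ≤ ‖u z‖ := norm_nonneg _
      rw [Real.norm_of_nonneg (by positivity)]
      simp only [Pi.add_apply]
      rw [← sq_abs α]
      nlinarith [sq_nonneg (‖f z‖ - |α| * g z)]
    have hzero := eq_zero_of_wirtingerDBar_eq hs
      (P := fun z => u z * u z + (β ^ 2 : ℂ) * (g z * g z))
      (N := fun z => ‖u z‖ ^ 2 + β ^ 2 * g z ^ 2)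
      (fun z => ((hud z).fun_mul (hud z)).add (((hgd z).fun_mul (hgd z)).const_mul _))
      (by
        have : u 0 = β * I := by
          simp only [hu, hg, map_zero, mul_zero, Real.exp_zero, ofReal_one, mul_one]
          linear_combination -re_add_im (f 0)
        simp only [this, hg, map_zero, mul_zero, Real.exp_zero, ofReal_one, mul_one]
        linear_combination (β : ℂ) ^ 2 * I_sq)
      (by fun_prop) (hui.add (hgi.const_mul _))
      (fun z => by
        refine (norm_add_le _ _).trans_eq ?_
        simp [pow_two])
      (fun z => by
        rw [wirtingerDBar_add ((hud z).fun_mul (hud z)) (((hgd z).fun_mul (hgd z)).const_mul _),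
          wirtingerDBar_const_mul _ ((hgd z).fun_mul (hgd z)), wirtingerDBar_mul (hud z) (hud z),
          wirtingerDBar_mul (hgd z) (hgd z), huD, hgD]
        push_cast
        rw [← mul_conj']
        ring)
    refine ⟨α, fun z => ?_⟩
    have hz := congrFun hzero z
    simp only [Pi.zero_apply] at hz
    have hu0 : u z = 0 := by
      have : ‖u z‖ ^ 2 = 0 := by nlinarith [sq_nonneg ‖u z‖, sq_nonneg (β * g z)]
      simpa using this
    simp only [hu] at hu0
    linear_combination hu0
  · rintro ⟨c, hc⟩ z
    rw [funext hc, wirtingerDBar_const_mul _ (differentiableAt_gaussian s z),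
      wirtingerDBar_gaussian]
    simp only [map_mul, conj_ofReal]
    ring
end

section
/- Fix s > 0. Let g : ℂ → ℂ be real-differentiable at every point with ∫_ℂ |g(z)|² dA(z) < ∞ (Lebesgue measure on ℂ ≅ ℝ²). If −∂g(z) + s·z·conj(g(z)) = 0 for all z ∈ ℂ, then g is identically zero. -/
open MeasureTheory

/-- The Wirtinger derivative `∂g(z) = ½(Dg(z)(1) − i·Dg(z)(i))`. -/
noncomputable def wirtingerD (g : ℂ → ℂ) (z : ℂ) : ℂ :=
  (1 / 2 : ℂ) * (fderiv ℝ g z 1 - Complex.I * fderiv ℝ g z Complex.I)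

theorem wirtingerD_mul {f g : ℂ → ℂ} {z : ℂ} (hf : DifferentiableAt ℝ f z)
    (hg : DifferentiableAt ℝ g z) :
    wirtingerD (fun w => f w * g w) z = f z * wirtingerD g z + g z * wirtingerD f z := by
  simp only [wirtingerD, fderiv_fun_mul hf hg, add_apply, smul_apply, smul_eq_mul]
  ring

theorem differentiable_conj_real : Differentiable ℝ (starRingEnd ℂ) :=
  Complex.conjCLE.differentiable

theorem wirtingerD_conj (z : ℂ) : wirtingerD (starRingEnd ℂ) z = 0 := by
  have h : fderiv ℝ (starRingEnd ℂ) z = (Complex.conjCLE : ℂ →L[ℝ] ℂ) :=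
    Complex.conjCLE.hasFDerivAt.fderiv
  simp [wirtingerD, h]

/-- The square of the positive part is differentiable, with derivative twice the positive part. -/
theorem hasDerivAt_max_zero_sq (t : ℝ) :
    HasDerivAt (fun x : ℝ => max 0 x ^ 2) (2 * max 0 t) t := by
  rcases lt_trichotomy t 0 with ht | rfl | ht
  · rw [max_eq_left ht.le, mul_zero]
    refine (hasDerivAt_const t (0 : ℝ)).congr_of_eventuallyEq ?_
    filter_upwards [Iio_mem_nhds ht] with x hx
    simp [max_eq_left (Set.mem_Iio.1 hx).le]
  · simp only [max_self, mul_zero]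
    rw [hasDerivAt_iff_isLittleO_nhds_zero]
    have h : (fun x : ℝ => x ^ 2) =o[nhds 0] fun x => x := by
      simpa using Asymptotics.isLittleO_pow_id (𝕜 := ℝ) one_lt_two
    refine Asymptotics.IsBigO.trans_isLittleO (.of_bound 1 (.of_forall fun x => ?_)) h
    rcases le_total x 0 with hx | hx <;> simp [hx, sq_nonneg]
  · rw [max_eq_right ht.le]
    have h := hasDerivAt_pow 2 t
    refine (by simpa using h : HasDerivAt (fun x : ℝ => x ^ 2) (2 * t) t).congr_of_eventuallyEq ?_
    filter_upwards [Ioi_mem_nhds ht] with x hx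
    rw [max_eq_right (Set.mem_Ioi.1 hx).le]

/-- The truncated paraboloid `(1 - ε|z|²)₊`. -/
noncomputable def paraboloid (ε : ℝ) (z : ℂ) : ℝ := max 0 (1 - ε * ‖z‖ ^ 2)

theorem paraboloid_nonneg (ε : ℝ) (z : ℂ) : 0 ≤ paraboloid ε z := le_max_left _ _

theorem continuous_paraboloid (ε : ℝ) : Continuous (paraboloid ε) := by
  unfold paraboloid; fun_prop

theorem paraboloid_anti {ε δ : ℝ} (h : ε ≤ δ) (z : ℂ) : paraboloid δ z ≤ paraboloid ε z :=
  max_le_max le_rfl (by gcongr)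

theorem mul_sq_mul_paraboloid_le_one {ε : ℝ} (hε : 0 ≤ ε) (z : ℂ) :
    ε * ‖z‖ ^ 2 * paraboloid ε z ≤ 1 := by
  have h : 0 ≤ ε * ‖z‖ ^ 2 := by positivity
  rcases le_total (1 - ε * ‖z‖ ^ 2) 0 with h' | h'
  · simp [paraboloid, max_eq_left h']
  · rw [paraboloid, max_eq_right h']
    nlinarith

theorem paraboloid_eq_zero {ε : ℝ} (hε : 0 < ε) {z : ℂ} (hz : (√ε)⁻¹ ≤ ‖z‖) :
    paraboloid ε z = 0 := by
  have hs : 0 < √ε := Real.sqrt_pos.2 hε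
  have h1 : 1 ≤ √ε * ‖z‖ := by
    rwa [inv_le_iff_one_le_mul₀' hs] at hz
  have h2 : 1 ≤ ε * ‖z‖ ^ 2 := by
    calc (1 : ℝ) ≤ (√ε * ‖z‖) ^ 2 := one_le_pow₀ h1
      _ = ε * ‖z‖ ^ 2 := by rw [mul_pow, Real.sq_sqrt hε.le]
  exact max_eq_left (by linarith)

theorem hasCompactSupport_paraboloid {ε : ℝ} (hε : 0 < ε) :
    HasCompactSupport (paraboloid ε) :=
  HasCompactSupport.of_support_subset_isCompact (isCompact_closedBall (0 : ℂ) (√ε)⁻¹) <| by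
    intro z hz
    by_contra h
    exact hz (paraboloid_eq_zero hε (by simpa using (not_le.1 (by simpa using h)).le))

theorem hasFDerivAt_paraboloid_sq (ε : ℝ) (z : ℂ) :
    HasFDerivAt (fun w => ((paraboloid ε w ^ 2 : ℝ) : ℂ))
      (Complex.ofRealCLM.comp
        ((2 * paraboloid ε z) • -(ε • (2 • innerSL ℝ z)))) z := by
  have h1 : HasFDerivAt (fun w : ℂ => 1 - ε * ‖w‖ ^ 2) (-(ε • (2 • innerSL ℝ z))) z :=
    ((hasStrictFDerivAt_norm_sq z).hasFDerivAt.const_mul ε).const_sub 1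
  have h2 : HasFDerivAt (fun w => paraboloid ε w ^ 2)
      ((2 * paraboloid ε z) • (-(ε • (2 • innerSL ℝ z)) : ℂ →L[ℝ] ℝ)) z :=
    HasDerivAt.comp_hasFDerivAt (h₂ := fun t : ℝ => max 0 t ^ 2) z (hasDerivAt_max_zero_sq _) h1
  exact Complex.ofRealCLM.hasFDerivAt.comp z h2

theorem wirtingerD_paraboloid_sq (ε : ℝ) (z : ℂ) :
    wirtingerD (fun w => ((paraboloid ε w ^ 2 : ℝ) : ℂ)) z
      = -(2 * ε * paraboloid ε z) * (starRingEnd ℂ) z := by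
  rw [wirtingerD, (hasFDerivAt_paraboloid_sq ε z).fderiv]
  apply Complex.ext <;> simp [Complex.inner] <;> ring

/-- The Wirtinger derivative of a compactly supported function has integral zero. -/
theorem integral_wirtingerD_eq_zero {F : ℂ → ℂ} (hF : Differentiable ℝ F) {R : ℝ} (hR : 0 ≤ R)
    (hsupp : ∀ z, R ≤ ‖z‖ → F z = 0) (hint : Integrable (wirtingerD F)) :
    ∫ z, wirtingerD F z = 0 := by
  set e : (ℝ × ℝ) ≃L[ℝ] ℂ := Complex.equivRealProdCLM.symm
  have he1 : e (1, 0) = 1 := rfl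
  have he2 : e (0, 1) = Complex.I := rfl
  have hmp := Complex.volume_preserving_equiv_real_prod.symm
  have hFz : ∀ z, R < ‖z‖ → wirtingerD F z = 0 := by
    intro z hz
    have h : F =ᶠ[nhds z] fun _ => 0 := by
      filter_upwards [(isOpen_lt continuous_const continuous_norm).mem_nhds hz] with w hw
      exact hsupp w (le_of_lt hw)
    simp [wirtingerD, h.fderiv_eq]
  have hre : ∀ p : ℝ × ℝ, |p.1| ≤ ‖e p‖ := fun p => Complex.abs_re_le_norm (e p)
  have him : ∀ p : ℝ × ℝ, |p.2| ≤ ‖e p‖ := fun p => Complex.abs_im_le_norm (e p)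
  have hd : ∀ p, HasFDerivAt (fun p => (1 / 2 : ℂ) * F (e p))
      ((1 / 2 : ℂ) • (fderiv ℝ F (e p)).comp (e : ℝ × ℝ →L[ℝ] ℂ)) p := fun p =>
    ((hF (e p)).hasFDerivAt.comp p e.hasFDerivAt).const_mul _
  have hd' : ∀ p, HasFDerivAt (fun p => -Complex.I * ((1 / 2 : ℂ) * F (e p)))
      (-Complex.I • ((1 / 2 : ℂ) • (fderiv ℝ F (e p)).comp (e : ℝ × ℝ →L[ℝ] ℂ))) p := fun p =>
    (hd p).const_mul _
  have hdiv : ∀ p : ℝ × ℝ, ((1 / 2 : ℂ) • (fderiv ℝ F (e p)).comp (e : ℝ × ℝ →L[ℝ] ℂ)) (1, 0)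
      + (-Complex.I • ((1 / 2 : ℂ) • (fderiv ℝ F (e p)).comp (e : ℝ × ℝ →L[ℝ] ℂ))) (0, 1)
      = wirtingerD F (e p) := by
    intro p
    simp [wirtingerD, he1, he2]
    ring
  have hint' : Integrable (fun p => wirtingerD F (e p)) :=
    (hmp.integrable_comp_emb (MeasurableEquiv.measurableEmbedding _)).2 hint
  have key := integral_divergence_prod_Icc_of_hasFDerivAt_of_le
    _ _ _ _ (-R, -R) (R, R) (Prod.mk_le_mk.2 ⟨by linarith, by linarith⟩)
    (fun p _ => (hd p).continuousAt.continuousWithinAt)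
    (fun p _ => (hd' p).continuousAt.continuousWithinAt)
    (fun p _ => hd p) (fun p _ => hd' p)
    (by simpa only [hdiv] using hint'.integrableOn)
  have hb1 : ∀ x, F (e (x, R)) = 0 := fun x =>
    hsupp _ ((le_abs_self R).trans (him (x, R)))
  have hb2 : ∀ x, F (e (x, -R)) = 0 := fun x =>
    hsupp _ (((le_abs_self R).trans_eq (abs_neg R).symm).trans (him (x, -R)))
  have hb3 : ∀ x, F (e (R, x)) = 0 := fun x =>
    hsupp _ ((le_abs_self R).trans (hre (R, x)))
  have hb4 : ∀ x, F (e (-R, x)) = 0 := fun x =>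
    hsupp _ (((le_abs_self R).trans_eq (abs_neg R).symm).trans (hre (-R, x)))
  simp only [hdiv, hb1, hb2, hb3, hb4, mul_zero, intervalIntegral.integral_zero, sub_self,
    add_zero] at key
  rw [setIntegral_eq_integral_of_forall_compl_eq_zero] at key
  · rw [← key]
    exact (hmp.integral_comp (MeasurableEquiv.measurableEmbedding _) (wirtingerD F)).symm
  · intro p hp
    refine hFz _ (lt_of_not_ge fun h => hp ?_)
    have h1 := abs_le.1 ((hre p).trans h)
    have h2 := abs_le.1 ((him p).trans h)
    exact ⟨⟨h1.1, h2.1⟩, ⟨h1.2, h2.2⟩⟩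

theorem wirtingerD_paraboloid_sq_mul_conj_mul_sq {s : ℝ} {g : ℂ → ℂ} (hg : Differentiable ℝ g)
    (heq : ∀ z, wirtingerD g z = s * z * (starRingEnd ℂ) (g z)) (ε : ℝ) (z : ℂ) :
    wirtingerD (fun w => ((paraboloid ε w ^ 2 : ℝ) : ℂ) * ((starRingEnd ℂ) w * (g w * g w))) z
      = ((2 * s * (paraboloid ε z ^ 2 * (‖z‖ ^ 2 * ‖g z‖ ^ 2)) : ℝ) : ℂ)
        - 2 * (ε * paraboloid ε z * (starRingEnd ℂ) z ^ 2 * g z ^ 2) := by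
  have hc := differentiable_conj_real z
  have hgg : DifferentiableAt ℝ (fun w => g w * g w) z := (hg z).mul (hg z)
  have hcg : DifferentiableAt ℝ (fun w => (starRingEnd ℂ) w * (g w * g w)) z := hc.mul hgg
  rw [wirtingerD_mul (hasFDerivAt_paraboloid_sq ε z).differentiableAt hcg,
    wirtingerD_paraboloid_sq, wirtingerD_mul hc hgg, wirtingerD_conj, wirtingerD_mul (hg z) (hg z),
    heq]
  push_cast
  rw [← Complex.mul_conj' z, ← Complex.mul_conj' (g z)]
  ring

theorem mul_integral_paraboloid_sq_le {s : ℝ} {g : ℂ → ℂ} (hg : Differentiable ℝ g)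
    (heq : ∀ z, wirtingerD g z = s * z * (starRingEnd ℂ) (g z)) {ε : ℝ} (hε : 0 < ε) :
    s * ∫ z, paraboloid ε z ^ 2 * (‖z‖ ^ 2 * ‖g z‖ ^ 2)
      ≤ ∫ z, ε * ‖z‖ ^ 2 * paraboloid ε z * ‖g z‖ ^ 2 := by
  have hgc : Continuous g := hg.continuous
  have hpc := continuous_paraboloid ε
  have hps := hasCompactSupport_paraboloid hε
  set A : ℂ → ℝ := fun z => 2 * s * (paraboloid ε z ^ 2 * (‖z‖ ^ 2 * ‖g z‖ ^ 2))
  set B : ℂ → ℂ := fun z => 2 * (ε * paraboloid ε z * (starRingEnd ℂ) z ^ 2 * g z ^ 2)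
  have hA : Integrable A := by
    refine Continuous.integrable_of_hasCompactSupport (by fun_prop) (hps.mono fun z hz h => hz ?_)
    simp [A, h]
  have hA' : Integrable (fun z => (A z : ℂ)) := hA.ofReal
  have hB : Integrable B := by
    refine Continuous.integrable_of_hasCompactSupport (by fun_prop) (hps.mono fun z hz h => hz ?_)
    simp [B, h]
  have hW : ∀ z, wirtingerD (fun w => ((paraboloid ε w ^ 2 : ℝ) : ℂ)
      * ((starRingEnd ℂ) w * (g w * g w))) z = (A z : ℂ) - B z :=
    wirtingerD_paraboloid_sq_mul_conj_mul_sq hg heq ε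
  have hF : Differentiable ℝ (fun w => ((paraboloid ε w ^ 2 : ℝ) : ℂ)
      * ((starRingEnd ℂ) w * (g w * g w))) := fun z =>
    (hasFDerivAt_paraboloid_sq ε z).differentiableAt.mul
      ((differentiable_conj_real z).mul ((hg z).mul (hg z)))
  have hzero := integral_wirtingerD_eq_zero hF (R := (√ε)⁻¹) (by positivity)
    (fun z hz => by simp [paraboloid_eq_zero hε hz])
    ((hA'.sub hB).congr (.of_forall fun z => (hW z).symm))
  rw [integral_congr_ae (.of_forall hW), integral_sub hA' hB, sub_eq_zero,
    integral_complex_ofReal] at hzero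
  have hnorm : ∀ z, ‖B z‖ = 2 * (ε * ‖z‖ ^ 2 * paraboloid ε z * ‖g z‖ ^ 2) := by
    intro z
    simp only [B, norm_mul, norm_pow, Complex.norm_real, RCLike.norm_conj, Complex.norm_ofNat,
      Real.norm_of_nonneg hε.le, Real.norm_of_nonneg (paraboloid_nonneg ε z)]
    ring
  have h := norm_integral_le_integral_norm (μ := volume) B
  rw [← hzero, Complex.norm_real, integral_congr_ae (.of_forall hnorm), integral_const_mul,
    integral_const_mul] at h
  linarith [(le_abs_self _).trans h]

theorem tendsto_integral_mul_sq_mul_paraboloid {g : ℂ → ℂ} (hg : Continuous g)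
    (hL2 : Integrable (fun z : ℂ => ‖g z‖ ^ 2)) :
    Filter.Tendsto (fun ε : ℝ => ∫ z, ε * ‖z‖ ^ 2 * paraboloid ε z * ‖g z‖ ^ 2)
      (nhdsWithin 0 (Set.Ioi 0)) (nhds 0) := by
  suffices h : Filter.Tendsto (fun ε : ℝ => ∫ z, ε * ‖z‖ ^ 2 * paraboloid ε z * ‖g z‖ ^ 2)
      (nhdsWithin 0 (Set.Ioi 0)) (nhds (∫ _ : ℂ, (0 : ℝ))) by
    simpa only [integral_zero] using h
  refine tendsto_integral_filter_of_dominated_convergence (fun z => ‖g z‖ ^ 2) ?_ ?_ hL2 ?_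
  · refine .of_forall fun ε => Continuous.aestronglyMeasurable ?_
    have := continuous_paraboloid ε
    fun_prop
  · filter_upwards [self_mem_nhdsWithin] with ε hε
    refine .of_forall fun z => ?_
    have hε' : (0 : ℝ) ≤ ε := (Set.mem_Ioi.1 hε).le
    have hp := paraboloid_nonneg ε z
    rw [Real.norm_of_nonneg (by positivity)]
    exact mul_le_of_le_one_left (by positivity) (mul_sq_mul_paraboloid_le_one hε' z)
  · refine .of_forall fun z => tendsto_nhdsWithin_of_tendsto_nhds ?_
    have h : Continuous fun ε : ℝ => ε * ‖z‖ ^ 2 * paraboloid ε z * ‖g z‖ ^ 2 := by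
      unfold paraboloid; fun_prop
    simpa using h.tendsto 0

/-- Example 1 of the paper: the adjoint operator `D'_s g = −∂g + s·z·ḡ`
has trivial kernel among L² functions. -/
theorem stmt7 (s : ℝ) (hs : 0 < s) (g : ℂ → ℂ)
    (hg : ∀ z : ℂ, DifferentiableAt ℝ g z)
    (hL2 : Integrable (fun z : ℂ => ‖g z‖ ^ 2))
    (heq : ∀ z : ℂ, -(wirtingerD g z) + (s : ℂ) * z * (starRingEnd ℂ) (g z) = 0) :
    ∀ z : ℂ, g z = 0 := by
  have heq' : ∀ z, wirtingerD g z = s * z * (starRingEnd ℂ) (g z) := fun z => by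
    linear_combination -(heq z)
  have hgc : Continuous g := Differentiable.continuous hg
  have hint : ∀ ε : ℝ, 0 < ε →
      Integrable (fun z => paraboloid ε z ^ 2 * (‖z‖ ^ 2 * ‖g z‖ ^ 2)) := fun ε hε => by
    have hpc := continuous_paraboloid ε
    refine Continuous.integrable_of_hasCompactSupport (by fun_prop)
      ((hasCompactSupport_paraboloid hε).mono fun z hz h => hz ?_)
    simp [h]
  have hzero : ∀ δ : ℝ, 0 < δ → ∫ z, paraboloid δ z ^ 2 * (‖z‖ ^ 2 * ‖g z‖ ^ 2) = 0 := by
    intro δ hδ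
    refine le_antisymm ?_ (integral_nonneg fun z => by positivity)
    refine nonpos_of_mul_nonpos_right ?_ hs
    refine ge_of_tendsto (tendsto_integral_mul_sq_mul_paraboloid hgc hL2) ?_
    filter_upwards [Ioc_mem_nhdsGT hδ] with ε hε
    refine le_trans ?_ (mul_integral_paraboloid_sq_le hg heq' hε.1)
    refine mul_le_mul_of_nonneg_left (integral_mono (hint δ hδ) (hint ε hε.1) fun z => ?_) hs.le
    have := paraboloid_nonneg δ z
    have := paraboloid_anti hε.2 z
    dsimp only
    gcongr
  have hne : ∀ z : ℂ, z ≠ 0 → g z = 0 := by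
    intro z hz
    have hz' : 0 < ‖z‖ ^ 2 := by positivity
    set δ : ℝ := (2 * ‖z‖ ^ 2)⁻¹
    have hδ : 0 < δ := by positivity
    have hpc := continuous_paraboloid δ
    have hae := (integral_eq_zero_iff_of_nonneg (fun z => by positivity) (hint δ hδ)).1
      (hzero δ hδ)
    have hfun := congrFun ((Continuous.ae_eq_iff_eq volume (by fun_prop) continuous_zero).1 hae) z
    have hp : paraboloid δ z = 1 / 2 := by
      have : δ * ‖z‖ ^ 2 = 1 / 2 := by simp only [δ]; field_simp
      rw [paraboloid, this]; norm_num
    simpa [hp, hz] using hfun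
  have hext : g = fun _ => 0 :=
    Continuous.ext_on (dense_compl_singleton (0 : ℂ)) hgc continuous_const hne
  exact congrFun hext
end

section
/- Fix s > 0. Let g : ℂ → ℂ be real-differentiable at every point with ∫_ℂ |g(z)|² dA(z) < ∞ (Lebesgue measure on ℂ ≅ ℝ²). Then g satisfies −∂g(z) + s·conj(z)·conj(g(z)) = 0 for all z ∈ ℂ if and only if there exists a real constant c such that g(z) = c·i·exp(−s·|z|²) for all z ∈ ℂ. In particular this kernel is a one-dimensional real vector space. -/
open MeasureTheory

open Set Filter Topology Real intervalIntegral

lemma fderiv_self_sub_I_mul_fderiv (g : ℂ → ℂ) (z : ℂ) :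
    fderiv ℝ g z z - Complex.I * fderiv ℝ g z (Complex.I * z) = 2 * z * wirtingerD g z := by
  have h1 : z = z.re • (1 : ℂ) + z.im • Complex.I := by
    simp [Complex.re_add_im]
  have h2 : Complex.I * z = (-z.im) • (1 : ℂ) + z.re • Complex.I := by
    apply Complex.ext <;> simp
  have e1 : fderiv ℝ g z z = z.re * fderiv ℝ g z 1 + z.im * fderiv ℝ g z Complex.I := by
    conv_lhs => rw [congrArg (fderiv ℝ g z) h1]
    rw [map_add, map_smul, map_smul, Complex.real_smul, Complex.real_smul]
  have e2 : fderiv ℝ g z (Complex.I * z)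
      = -z.im * fderiv ℝ g z 1 + z.re * fderiv ℝ g z Complex.I := by
    rw [h2, map_add, map_smul, map_smul, Complex.real_smul, Complex.real_smul, Complex.ofReal_neg]
  rw [e1, e2, wirtingerD]
  linear_combination (fderiv ℝ g z 1 - Complex.I * fderiv ℝ g z Complex.I) * Complex.re_add_im z
    + z.im * fderiv ℝ g z Complex.I * Complex.I_sq

lemma hasFDerivAt_circleMap_uncurry (p : ℝ × ℝ) :
    ∃ L : ℝ × ℝ →L[ℝ] ℂ, HasFDerivAt (fun q : ℝ × ℝ => circleMap 0 q.1 q.2) L p ∧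
      (p.1 : ℂ) * L (1, 0) = circleMap 0 p.1 p.2 ∧
      L (0, 1) = Complex.I * circleMap 0 p.1 p.2 := by
  have h1 : HasFDerivAt (fun q : ℝ × ℝ => (q.1 : ℂ))
      (Complex.ofRealCLM.comp (ContinuousLinearMap.fst ℝ ℝ ℝ)) p :=
    (Complex.ofRealCLM.comp (ContinuousLinearMap.fst ℝ ℝ ℝ)).hasFDerivAt
  have h2 : HasFDerivAt (fun q : ℝ × ℝ => (q.2 : ℂ))
      (Complex.ofRealCLM.comp (ContinuousLinearMap.snd ℝ ℝ ℝ)) p :=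
    (Complex.ofRealCLM.comp (ContinuousLinearMap.snd ℝ ℝ ℝ)).hasFDerivAt
  have h3 := h1.mul (h2.mul_const Complex.I).cexp
  refine ⟨_, h3.congr_of_eventuallyEq (Eventually.of_forall fun q => by simp [circleMap]), ?_, ?_⟩
  · simp [circleMap]
  · simp [circleMap]
    ring

/-- On annuli, Stokes' theorem for `g² dz / z` turns the equation `∂g = s z̄ ḡ` into an identity
for the circle integrals of `g²`. -/
lemma integral_sq_circleMap_sub {s : ℝ} {g : ℂ → ℂ} (hg : ∀ z, DifferentiableAt ℝ g z)
    (h : ∀ z, wirtingerD g z = s * starRingEnd ℂ z * starRingEnd ℂ (g z))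
    {ε R : ℝ} (hε : 0 < ε) (hR : ε ≤ R) :
    (∫ θ in -π..π, g (circleMap 0 R θ) ^ 2) - ∫ θ in -π..π, g (circleMap 0 ε θ) ^ 2
      = ((4 * s * ∫ r in ε..R, r * ∫ θ in -π..π, ‖g (circleMap 0 r θ)‖ ^ 2 : ℝ) : ℂ) := by
  have gc : Continuous g := continuous_iff_continuousAt.2 fun z => (hg z).continuousAt
  choose L hL hL1 hL2 using hasFDerivAt_circleMap_uncurry
  let G' : ℝ × ℝ → ℝ × ℝ →L[ℝ] ℂ := fun p =>
    (2 * g (circleMap 0 p.1 p.2)) • (fderiv ℝ g (circleMap 0 p.1 p.2)).comp (L p)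
  have hG (p : ℝ × ℝ) : HasFDerivAt (fun q : ℝ × ℝ => g (circleMap 0 q.1 q.2) ^ 2) (G' p) p := by
    have := ((hg (circleMap 0 p.1 p.2)).hasFDerivAt.comp p (hL p)).pow 2
    simpa [G', Function.comp_def] using this
  let w : ℝ × ℝ → ℂ := fun q => -Complex.I * ((q.1⁻¹ : ℝ) : ℂ)
  have hw (p : ℝ × ℝ) (hp : 0 < p.1) :
      ∃ W : ℝ × ℝ →L[ℝ] ℂ, HasFDerivAt w W p ∧ W (0, 1) = 0 := by
    have h1 : HasFDerivAt (fun q : ℝ × ℝ => q.1⁻¹) _ p :=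
      (hasDerivAt_inv hp.ne').comp_hasFDerivAt p (hasFDerivAt_fst (𝕜 := ℝ))
    have h2 := (Complex.ofRealCLM.hasFDerivAt.comp p h1).const_mul (-Complex.I)
    exact ⟨_, h2, by simp⟩
  choose! W hW hW0 using hw
  let K' : ℝ × ℝ → ℝ × ℝ →L[ℝ] ℂ := fun p =>
    w p • G' p + (g (circleMap 0 p.1 p.2) ^ 2) • W p
  have hK (p : ℝ × ℝ) (hp : 0 < p.1) :
      HasFDerivAt (fun q : ℝ × ℝ => w q * g (circleMap 0 q.1 q.2) ^ 2) (K' p) p :=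
    (hW p hp).mul (hG p)
  have hdiv (p : ℝ × ℝ) (hp : 0 < p.1) : G' p (1, 0) + K' p (0, 1)
      = ((4 * s * (p.1 * ‖g (circleMap 0 p.1 p.2)‖ ^ 2) : ℝ) : ℂ) := by
    have hp' : (p.1 : ℂ) ≠ 0 := by exact_mod_cast hp.ne'
    set z := circleMap 0 p.1 p.2 with hz
    have hzz : z * starRingEnd ℂ z = (p.1 : ℂ) ^ 2 := by
      rw [Complex.mul_conj']
      simp [hz, ← Complex.ofReal_pow]
    have e := fderiv_self_sub_I_mul_fderiv g z
    have e1 : fderiv ℝ g z z = p.1 * fderiv ℝ g z (L p (1, 0)) := by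
      conv_lhs => rw [congrArg (fderiv ℝ g z) (hL1 p).symm]
      rw [← Complex.real_smul, map_smul, Complex.real_smul]
    rw [h, e1] at e
    have hgg : g z * starRingEnd ℂ (g z) = (‖g z‖ : ℂ) ^ 2 := Complex.mul_conj' _
    simp only [G', K', w, add_apply, smul_apply,
      ContinuousLinearMap.comp_apply, hW0 p hp, hL2, ← hz, smul_eq_mul]
    push_cast
    apply mul_left_cancel₀ hp'
    field_simp
    linear_combination 2 * g z * e + 4 * s * g z * starRingEnd ℂ (g z) * hzz
      + 4 * s * p.1 ^ 2 * hgg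
  have pos {x : ℝ × ℝ} (hx : x ∈ uIcc ε R ×ˢ uIcc (-π) π) : 0 < x.1 := by
    have := hx.1
    rw [uIcc_of_le hR] at this
    exact hε.trans_le this.1
  have pos' {x : ℝ × ℝ} (hx : x ∈ Ioo (min ε R) (max ε R) ×ˢ Ioo (min (-π) π) (max (-π) π)) :
      0 < x.1 := by
    have := hx.1.1
    rw [min_eq_left hR] at this
    exact hε.trans this
  have key := integral2_divergence_prod_of_hasFDerivAt
    (fun q : ℝ × ℝ => g (circleMap 0 q.1 q.2) ^ 2)
    (fun q : ℝ × ℝ => w q * g (circleMap 0 q.1 q.2) ^ 2) G' K' ε (-π) R π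
    (fun x _ => (hG x).continuousAt.continuousWithinAt)
    (fun x hx => (hK x (pos hx)).continuousAt.continuousWithinAt)
    (fun x _ => hG x) (fun x hx => hK x (pos' hx)) (by
      refine IntegrableOn.congr_fun
        (f := fun p => ((4 * s * (p.1 * ‖g (circleMap 0 p.1 p.2)‖ ^ 2) : ℝ) : ℂ)) ?_
        (fun x hx => (hdiv x (pos hx)).symm)
        (measurableSet_uIcc.prod measurableSet_uIcc)
      exact (by fun_prop : Continuous _).continuousOn.integrableOn_compact
        (isCompact_uIcc.prod isCompact_uIcc))
  have hper (r : ℝ) : circleMap 0 r π = circleMap 0 r (-π) := by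
    have := periodic_circleMap 0 r (-π)
    rw [← this]
    congr 1
    ring
  simp only [hper, w, sub_self, zero_add] at key
  rw [← key]
  calc _ = ∫ r in ε..R, ∫ θ in -π..π,
        ((4 * s * (r * ‖g (circleMap 0 r θ)‖ ^ 2) : ℝ) : ℂ) := by
        refine integral_congr fun r hr => integral_congr fun θ hθ => ?_
        exact hdiv (r, θ) (pos ⟨hr, hθ⟩)
    _ = _ := by
        simp only [intervalIntegral.integral_ofReal, intervalIntegral.integral_const_mul]

lemma integral_sq_circleMap_eq {s : ℝ} {g : ℂ → ℂ} (hg : ∀ z, DifferentiableAt ℝ g z)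
    (h : ∀ z, wirtingerD g z = s * starRingEnd ℂ z * starRingEnd ℂ (g z))
    {R : ℝ} (hR : 0 < R) :
    ∫ θ in -π..π, g (circleMap 0 R θ) ^ 2 = 2 * π * g 0 ^ 2
      + ((4 * s * ∫ r in 0..R, r * ∫ θ in -π..π, ‖g (circleMap 0 r θ)‖ ^ 2 : ℝ) : ℂ) := by
  have gc : Continuous g := continuous_iff_continuousAt.2 fun z => (hg z).continuousAt
  have c1 : Continuous fun ε : ℝ => (∫ θ in -π..π, g (circleMap 0 R θ) ^ 2)
      - ∫ θ in -π..π, g (circleMap 0 ε θ) ^ 2 := by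
    fun_prop
  have c0 : Continuous fun r : ℝ => r * ∫ θ in -π..π, ‖g (circleMap 0 r θ)‖ ^ 2 := by fun_prop
  have c2 : Continuous fun ε : ℝ =>
      ((4 * s * ∫ r in ε..R, r * ∫ θ in -π..π, ‖g (circleMap 0 r θ)‖ ^ 2 : ℝ) : ℂ) := by
    simp only [intervalIntegral.integral_symm R]
    have := intervalIntegral.continuous_primitive (μ := volume)
      (fun a b => c0.intervalIntegrable a b) R
    fun_prop
  have hev : (fun ε : ℝ => (∫ θ in -π..π, g (circleMap 0 R θ) ^ 2)
      - ∫ θ in -π..π, g (circleMap 0 ε θ) ^ 2) =ᶠ[𝓝[>] 0] fun ε : ℝ =>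
      ((4 * s * ∫ r in ε..R, r * ∫ θ in -π..π, ‖g (circleMap 0 r θ)‖ ^ 2 : ℝ) : ℂ) := by
    filter_upwards [Ioo_mem_nhdsGT hR] with ε hε
    exact integral_sq_circleMap_sub hg h hε.1 hε.2.le
  have := tendsto_nhds_unique ((c1.tendsto 0).mono_left nhdsWithin_le_nhds)
    (((c2.tendsto 0).mono_left nhdsWithin_le_nhds).congr' hev.symm)
  rw [← this]
  simp [circleMap]
  ring

lemma integrableOn_polarCoord_target {f : ℂ → ℝ} (fc : Continuous f) (hf : Integrable f) :
    IntegrableOn (fun p : ℝ × ℝ => p.1 * f (circleMap 0 p.1 p.2)) (Ioi 0 ×ˢ Ioo (-π) π) := by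
  refine ⟨(by fun_prop : Continuous _).aestronglyMeasurable, ?_⟩
  have := hf.2
  rw [HasFiniteIntegral, ← Complex.lintegral_comp_polarCoord_symm] at this
  rw [HasFiniteIntegral]
  refine lt_of_eq_of_lt ?_ this
  refine setLIntegral_congr_fun (measurableSet_Ioi.prod measurableSet_Ioo) fun p hp => ?_
  have hp1 : (0 : ℝ) < p.1 := hp.1
  simp [enorm_mul, Real.enorm_of_nonneg hp1.le, circleMap, Complex.exp_mul_I]

lemma integrableOn_mul_integral_circleMap {f : ℂ → ℝ} (fc : Continuous f) (hf : Integrable f) :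
    IntegrableOn (fun r : ℝ => r * ∫ θ in -π..π, f (circleMap 0 r θ)) (Ioi 0) := by
  have := integrableOn_polarCoord_target fc hf
  rw [IntegrableOn, Measure.volume_eq_prod, ← Measure.prod_restrict] at this
  refine this.integral_prod_left.congr (Eventually.of_forall fun r => ?_)
  simp only [MeasureTheory.integral_const_mul]
  rw [intervalIntegral.integral_of_le (by linarith [pi_pos]), integral_Ioc_eq_integral_Ioo]

lemma integral_mul_integral_circleMap {f : ℂ → ℝ} (fc : Continuous f) (hf : Integrable f) :
    ∫ r in Ioi (0 : ℝ), r * ∫ θ in -π..π, f (circleMap 0 r θ) = ∫ z, f z := by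
  have := integrableOn_polarCoord_target fc hf
  rw [← Complex.integral_comp_polarCoord_symm]
  rw [Measure.volume_eq_prod] at this
  have e := setIntegral_prod _ this
  calc _ = _ := ?_
    _ = _ := e.symm
    _ = _ := ?_
  · refine integral_congr_ae (Eventually.of_forall fun r => ?_)
    simp only [MeasureTheory.integral_const_mul]
    rw [intervalIntegral.integral_of_le (by linarith [pi_pos]), integral_Ioc_eq_integral_Ioo]
  · rw [← Measure.volume_eq_prod]
    refine setIntegral_congr_fun (measurableSet_Ioi.prod measurableSet_Ioo) fun p hp => ?_
    simp [circleMap, Complex.exp_mul_I]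

/-- The value at the origin of an `L²` solution of `∂g = s z̄ ḡ` determines its norm. -/
lemma sq_apply_zero_eq {s : ℝ} {g : ℂ → ℂ} (hg : ∀ z, DifferentiableAt ℝ g z)
    (hL2 : Integrable fun z => ‖g z‖ ^ 2)
    (h : ∀ z, wirtingerD g z = s * starRingEnd ℂ z * starRingEnd ℂ (g z)) :
    2 * π * g 0 ^ 2 + ((4 * s * ∫ z, ‖g z‖ ^ 2 : ℝ) : ℂ) = 0 := by
  have gc : Continuous g := continuous_iff_continuousAt.2 fun z => (hg z).continuousAt
  have fc : Continuous fun z => ‖g z‖ ^ 2 := by fun_prop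
  have hi := integrableOn_mul_integral_circleMap fc hL2
  have hlim := intervalIntegral_tendsto_integral_Ioi 0 hi tendsto_id
  rw [integral_mul_integral_circleMap fc hL2] at hlim
  set l := 2 * π * g 0 ^ 2 + ((4 * s * ∫ z, ‖g z‖ ^ 2 : ℝ) : ℂ) with hl
  have hQ : Tendsto (fun R : ℝ => ∫ θ in -π..π, g (circleMap 0 R θ) ^ 2) atTop (𝓝 l) := by
    have := ((Complex.continuous_ofReal.tendsto _).comp
      (hlim.const_mul (4 * s))).const_add (2 * π * g 0 ^ 2)
    refine this.congr' ?_
    filter_upwards [eventually_gt_atTop 0] with R hR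
    exact (integral_sq_circleMap_eq hg h hR).symm
  by_contra hne
  have hpos : 0 < ‖l‖ := norm_pos_iff.2 hne
  obtain ⟨R, hR⟩ := eventually_atTop.1
    (hQ.norm.eventually_const_le (half_lt_self hpos))
  have hc : IntegrableOn (fun _ : ℝ => ‖l‖ / 2) (Ioi (max R 1)) := by
    refine (hi.mono_set (Ioi_subset_Ioi (by positivity))).mono' (by fun_prop) ?_
    refine (ae_restrict_iff' measurableSet_Ioi).2 (Eventually.of_forall fun r hr => ?_)
    have hr' := max_lt_iff.1 (mem_Ioi.1 hr)
    have h1 : ‖∫ θ in -π..π, g (circleMap 0 r θ) ^ 2‖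
        ≤ ∫ θ in -π..π, ‖g (circleMap 0 r θ)‖ ^ 2 := by
      exact (intervalIntegral.norm_integral_le_integral_norm
        (by linarith [pi_pos])).trans_eq (integral_congr fun θ _ => norm_pow _ _)
    have h2 := hR r hr'.1.le
    rw [Real.norm_of_nonneg (by positivity)]
    nlinarith [h1, h2, hr'.2]
  rw [integrableOn_const_iff] at hc
  rcases hc with hc | hc
  · simp [hne] at hc
  · simp at hc

lemma hasFDerivAt_gaussian (s c : ℝ) (z : ℂ) :
    ∃ L : ℂ →L[ℝ] ℂ, HasFDerivAt
      (fun z : ℂ => (c : ℂ) * Complex.I * (Real.exp (-s * Complex.normSq z) : ℝ)) L z ∧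
      ∀ v, L v = c * Complex.I * (Real.exp (-s * Complex.normSq z) : ℝ)
        * (-s * (2 * (z.re * v.re + z.im * v.im))) := by
  have hr := Complex.reCLM.hasFDerivAt (x := z)
  have hi := Complex.imCLM.hasFDerivAt (x := z)
  have h1 := (((hr.mul hr).add (hi.mul hi)).const_mul (-s)).exp
  have h2 := (Complex.ofRealCLM.hasFDerivAt.comp z h1).const_mul (c * Complex.I)
  refine ⟨_, h2, fun v => ?_⟩
  simp [Complex.normSq_apply]
  ring

lemma wirtingerD_gaussian (s c : ℝ) (z : ℂ) :
    wirtingerD (fun z : ℂ => (c : ℂ) * Complex.I * (Real.exp (-s * Complex.normSq z) : ℝ)) z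
      = s * starRingEnd ℂ z
        * starRingEnd ℂ ((c : ℂ) * Complex.I * (Real.exp (-s * Complex.normSq z) : ℝ)) := by
  obtain ⟨L, hL, hv⟩ := hasFDerivAt_gaussian s c z
  rw [wirtingerD, hL.fderiv, hv, hv, map_mul, map_mul, Complex.conj_I, Complex.conj_ofReal,
    Complex.conj_ofReal]
  have : starRingEnd ℂ z = z.re - z.im * Complex.I := by apply Complex.ext <;> simp
  rw [this]
  simp
  ring

lemma integrable_norm_sq_gaussian {s : ℝ} (hs : 0 < s) (c : ℝ) :
    Integrable fun z : ℂ =>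
      ‖(c : ℂ) * Complex.I * (Real.exp (-s * Complex.normSq z) : ℝ)‖ ^ 2 := by
  have := (GaussianFourier.integrable_cexp_neg_mul_sq_norm_add (V := ℂ) (b := 2 * s)
    (by simpa using hs) 0 0).norm.const_mul (c ^ 2)
  refine this.congr (Eventually.of_forall fun z => ?_)
  have e : Real.exp (-s * Complex.normSq z) ^ 2 = Real.exp (-(2 * s * ‖z‖ ^ 2)) := by
    rw [← Real.exp_nat_mul, Complex.normSq_eq_norm_sq]
    congr 1
    push_cast
    ring
  simp only [norm_mul, Complex.norm_I, Complex.norm_real, mul_one, mul_pow, norm_eq_abs, sq_abs, e]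
  simp [Complex.norm_exp, ← Complex.ofReal_pow]

/-- Example 1 of the paper: the kernel of the adjoint of `f ↦ ∂̄f + s·z̄·f̄`
among L² functions is the one-dimensional real space `ℝ·(i·e^{−s|z|²})`. -/
theorem stmt9 (s : ℝ) (hs : 0 < s) (g : ℂ → ℂ)
    (hg : ∀ z : ℂ, DifferentiableAt ℝ g z)
    (hL2 : Integrable (fun z : ℂ => ‖g z‖ ^ 2)) :
    (∀ z : ℂ, -(wirtingerD g z)
        + (s : ℂ) * (starRingEnd ℂ) z * (starRingEnd ℂ) (g z) = 0)
      ↔ ∃ c : ℝ, ∀ z : ℂ,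
          g z = (c : ℂ) * Complex.I * (Real.exp (-s * Complex.normSq z) : ℝ) := by
  simp only [neg_add_eq_zero]
  constructor
  · intro h
    have gc : Continuous g := continuous_iff_continuousAt.2 fun z => (hg z).continuousAt
    have hre : (g 0).re = 0 := by
      have h0 := sq_apply_zero_eq hg hL2 h
      have h1 := congrArg Complex.re h0
      have h2 := congrArg Complex.im h0
      simp only [pow_two, Complex.add_re, Complex.add_im, Complex.mul_re, Complex.mul_im,
        Complex.ofReal_re, Complex.ofReal_im, Complex.re_ofNat, Complex.im_ofNat,
        Complex.zero_re, Complex.zero_im] at h1 h2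
      have h3 : (g 0).re * (g 0).im = 0 := by
        have : π * ((g 0).re * (g 0).im) = 0 := by linear_combination h2 / 4
        simpa [pi_ne_zero] using this
      rcases mul_eq_zero.1 h3 with h3 | h3
      · exact h3
      · rw [h3] at h1
        have hsN : 0 ≤ s * ∫ z, ‖g z‖ * ‖g z‖ :=
          mul_nonneg hs.le (MeasureTheory.integral_nonneg fun z => mul_self_nonneg _)
        have : 0 ≤ π * ((g 0).re * (g 0).re) := mul_nonneg pi_pos.le (mul_self_nonneg _)
        have : π * ((g 0).re * (g 0).re) = 0 := by linarith
        simpa [pi_ne_zero] using this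
    refine ⟨(g 0).im, ?_⟩
    set k : ℂ → ℂ := fun z =>
      ((g 0).im : ℂ) * Complex.I * (Real.exp (-s * Complex.normSq z) : ℝ) with hk
    have hkd (z : ℂ) : DifferentiableAt ℝ k z :=
      (hasFDerivAt_gaussian s (g 0).im z).choose_spec.1.differentiableAt
    have kc : Continuous k := continuous_iff_continuousAt.2 fun z => (hkd z).continuousAt
    have hd (z : ℂ) : DifferentiableAt ℝ (g - k) z := (hg z).sub (hkd z)
    have hdL2 : Integrable fun z => ‖(g - k) z‖ ^ 2 := by
      have hm1 := (memLp_two_iff_integrable_sq_norm gc.aestronglyMeasurable).2 hL2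
      have hm2 := (memLp_two_iff_integrable_sq_norm kc.aestronglyMeasurable).2
        (integrable_norm_sq_gaussian hs (g 0).im)
      exact (memLp_two_iff_integrable_sq_norm
        (gc.sub kc).aestronglyMeasurable).1 (hm1.sub hm2)
    have hdeq (z : ℂ) : wirtingerD (g - k) z
        = s * starRingEnd ℂ z * starRingEnd ℂ ((g - k) z) := by
      have e : wirtingerD (g - k) z = wirtingerD g z - wirtingerD k z := by
        simp only [wirtingerD, fderiv_sub (hg z) (hkd z), sub_apply]
        ring
      rw [e, h, wirtingerD_gaussian, Pi.sub_apply, map_sub]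
      ring
    have h0 : (g - k) 0 = 0 := by
      apply Complex.ext <;> simp [hk, hre]
    have hN := sq_apply_zero_eq hd hdL2 hdeq
    rw [h0] at hN
    have hN' : ∫ z, ‖(g - k) z‖ ^ 2 = 0 := by
      have : 4 * s * ∫ z, ‖(g - k) z‖ ^ 2 = 0 := by exact_mod_cast (by simpa using hN)
      simpa [hs.ne'] using this
    have hae := (integral_eq_zero_iff_of_nonneg (fun z => by positivity) hdL2).1 hN'
    have hz := (Continuous.ae_eq_iff_eq volume ((gc.sub kc).norm.pow 2) continuous_const).1 hae
    intro z
    have := congrFun hz z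
    exact sub_eq_zero.1 (norm_eq_zero.1 (pow_eq_zero_iff two_ne_zero |>.1 this))
  · rintro ⟨c, hc⟩ z
    have : g = _ := funext hc
    rw [this]
    exact wirtingerD_gaussian s c z
end
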